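/- arXiv:1409.3064 — 9 statements merged into one kernel-verified Lean document; each statement's English description precedes it below -/
import Mathlib

section
/- Let C ≥ 0 and let φ : ℝ → ℝ be a C-almost-isometry of the real line with its standard metric. Then φ lies at bounded distance from an isometry of ℝ: there exists a bijective isometry I : ℝ → ℝ and a constant B such that |φ(x) − I(x)| ≤ B for all x ∈ ℝ. -/
/-- A `C`-almost-isometric map of the line that does not reverse the order of `0` and `2 * C + 1`
is at distance at most `5 * C` from a translation. -/
theorem abs_sub_translation_le (C : ℝ) (hC : 0 ≤ C) (φ : ℝ → ℝ)
    (hai : ∀ x₁ x₂ : ℝ, |x₁ - x₂| - C ≤ |φ x₁ - φ x₂| ∧ |φ x₁ - φ x₂| ≤ |x₁ - x₂| + C)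
    (hpos : φ 0 ≤ φ (2 * C + 1)) (x : ℝ) : |φ x - (φ 0 + x)| ≤ 5 * C := by
  obtain ⟨h1, h2⟩ := hai x 0
  obtain ⟨h3, h4⟩ := hai x (2 * C + 1)
  obtain ⟨h5, h6⟩ := hai (2 * C + 1) 0
  rw [abs_of_nonneg (sub_nonneg.2 hpos), sub_zero, abs_of_nonneg (by linarith)] at h5 h6
  rw [sub_zero] at h1 h2
  rw [abs_le]
  rcases abs_cases x with ⟨e1, _⟩ | ⟨e1, _⟩ <;> rw [e1] at h1 h2 <;>
  rcases abs_cases (φ x - φ 0) with ⟨e2, _⟩ | ⟨e2, _⟩ <;> rw [e2] at h1 h2 <;>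
  rcases abs_cases (x - (2 * C + 1)) with ⟨e3, _⟩ | ⟨e3, _⟩ <;> rw [e3] at h3 h4 <;>
  rcases abs_cases (φ x - φ (2 * C + 1)) with ⟨e4, _⟩ | ⟨e4, _⟩ <;> rw [e4] at h3 h4 <;>
  constructor <;> linarith

/-- Every C-almost-isometry of the real line lies at bounded distance from a
bijective isometry of ℝ. -/
theorem stmt_3 (C : ℝ) (hC : 0 ≤ C) (φ : ℝ → ℝ)
    (hai : ∀ x₁ x₂ : ℝ, |x₁ - x₂| - C ≤ |φ x₁ - φ x₂| ∧ |φ x₁ - φ x₂| ≤ |x₁ - x₂| + C)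
    (honto : ∀ y : ℝ, ∃ x : ℝ, |φ x - y| ≤ C) :
    ∃ I : ℝ → ℝ, Function.Bijective I ∧ (∀ x y : ℝ, |I x - I y| = |x - y|) ∧
      ∃ B : ℝ, ∀ x : ℝ, |φ x - I x| ≤ B := by
  rcases le_total (φ 0) (φ (2 * C + 1)) with h | h
  · exact ⟨fun x => φ 0 + x, (Equiv.addLeft (φ 0)).bijective,
      fun x y => by rw [add_sub_add_left_eq_sub],
      5 * C, abs_sub_translation_le C hC φ hai h⟩
  · refine ⟨fun x => φ 0 - x, (Equiv.subLeft (φ 0)).bijective,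
      fun x y => by rw [sub_sub_sub_cancel_left, abs_sub_comm], 5 * C, fun x => ?_⟩
    have key := abs_sub_translation_le C hC (fun x => -φ x)
      (fun x₁ x₂ => by
        rw [neg_sub_neg, abs_sub_comm (φ x₂)]
        exact hai x₁ x₂) (neg_le_neg h) x
    rw [← abs_neg]
    convert key using 2
    ring
end

section
/- Let C ≥ 0 and let φ : ℝ² → ℝ² be a C-almost-isometry of the Euclidean plane (ℝ² with the standard Euclidean metric). Then φ lies at bounded distance from an isometry of the plane: there exists a bijective isometry I : ℝ² → ℝ² and a constant B such that ‖φ(x) − I(x)‖ ≤ B for all x ∈ ℝ². -/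
open Filter Topology in
/-- If `v` tends to a unit vector `w` along a filter finer than `atTop`, the normalized distance
functions to the points `n • v n` converge to the Busemann function of the direction `w`. -/
theorem tendsto_norm_sub_smul_sub_norm_smul {E : Type*} [NormedAddCommGroup E]
    [InnerProductSpace ℝ E] {l : Filter ℕ} (hl : l ≤ atTop) {v : ℕ → E} {w : E}
    (hv : Tendsto v l (𝓝 w)) (hw : ‖w‖ = 1) (y : E) :
    Tendsto (fun n : ℕ => ‖y - (n : ℝ) • v n‖ - ‖(n : ℝ) • v n‖) l (𝓝 (-inner ℝ y w)) := by
  have hinv : Tendsto (fun n : ℕ => (n : ℝ)⁻¹) l (𝓝 0) :=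
    tendsto_inv_atTop_nhds_zero_nat.mono_left hl
  have hpos : ∀ᶠ n : ℕ in l, 0 < n := hl (eventually_gt_atTop 0)
  have hne : ∀ᶠ n : ℕ in l, 0 < ‖v n‖ :=
    hv.norm.eventually (lt_mem_nhds (by rw [hw]; exact one_pos))
  have hden : Tendsto (fun n : ℕ => ‖(n : ℝ)⁻¹ • y - v n‖ + ‖v n‖) l (𝓝 2) := by
    have h := (((hinv.smul_const y).sub hv).norm).add hv.norm
    rw [zero_smul, zero_sub, norm_neg, hw] at h
    norm_num at h
    exact h
  have hnum : Tendsto (fun n : ℕ => (n : ℝ)⁻¹ * ‖y‖ ^ 2 - 2 * inner ℝ y (v n)) l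
      (𝓝 (0 * ‖y‖ ^ 2 - 2 * inner ℝ y w)) :=
    (hinv.mul_const _).sub ((tendsto_const_nhds.inner hv).const_mul 2)
  have hlim := hnum.div hden two_ne_zero
  have heq : (0 * ‖y‖ ^ 2 - 2 * inner ℝ y w) / 2 = -inner ℝ y w := by ring
  rw [heq] at hlim
  refine hlim.congr' ?_
  filter_upwards [hpos, hne] with n hn hvn
  have hn' : (0 : ℝ) < n := Nat.cast_pos.mpr hn
  have hscale : ‖y - (n : ℝ) • v n‖ = n * ‖(n : ℝ)⁻¹ • y - v n‖ := by
    rw [← Real.norm_of_nonneg hn'.le, ← norm_smul, Real.norm_of_nonneg hn'.le, smul_sub,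
      smul_inv_smul₀ hn'.ne']
  have hsq := norm_sub_sq_real ((n : ℝ)⁻¹ • y) (v n)
  rw [norm_smul, real_inner_smul_left, Real.norm_of_nonneg (inv_nonneg.mpr hn'.le)] at hsq
  simp only [Pi.div_apply]
  rw [hscale, norm_smul, Real.norm_of_nonneg hn'.le, div_eq_iff (by positivity)]
  have hid : (n : ℝ) * (‖(n : ℝ)⁻¹ • y - v n‖ ^ 2 - ‖v n‖ ^ 2)
      = (n : ℝ)⁻¹ * ‖y‖ ^ 2 - 2 * inner ℝ y (v n) := by
    rw [hsq]
    field_simp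
    ring
  rw [← hid]
  ring

open Filter Topology in
/-- An almost-isometry of a proper space fixing the origin has an asymptotic cone, which is an
isometry. -/
theorem exists_isometry_tendsto_inv_smul {E : Type*} [NormedAddCommGroup E] [NormedSpace ℝ E]
    [ProperSpace E] {C : ℝ} {f : E → E} (hf0 : f 0 = 0)
    (hf : ∀ x y, |dist (f x) (f y) - dist x y| ≤ C) :
    ∃ U : E → E, Isometry U ∧ U 0 = 0 ∧
      ∀ x, Tendsto (fun n : ℕ => (n : ℝ)⁻¹ • f ((n : ℝ) • x)) (hyperfilter ℕ) (𝓝 (U x)) := by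
  have hC : 0 ≤ C := (abs_nonneg _).trans (hf 0 0)
  have hpos : ∀ᶠ n : ℕ in hyperfilter ℕ, 0 < n := Nat.hyperfilter_le_atTop (eventually_gt_atTop 0)
  have hdist : ∀ x y, ∀ n : ℕ, 0 < n →
      |dist ((n : ℝ)⁻¹ • f ((n : ℝ) • x)) ((n : ℝ)⁻¹ • f ((n : ℝ) • y)) - dist x y|
        ≤ (n : ℝ)⁻¹ * C := by
    intro x y n hn
    have hn' : (0 : ℝ) < n := Nat.cast_pos.mpr hn
    have h := hf ((n : ℝ) • x) ((n : ℝ) • y)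
    rw [dist_smul₀ (n : ℝ) x y, Real.norm_of_nonneg hn'.le] at h
    rw [dist_smul₀, Real.norm_of_nonneg (inv_nonneg.mpr hn'.le)]
    calc _ = (n : ℝ)⁻¹ * |dist (f ((n : ℝ) • x)) (f ((n : ℝ) • y)) - n * dist x y| := by
          rw [← abs_of_nonneg (inv_nonneg.mpr hn'.le), ← abs_mul,
            abs_of_nonneg (inv_nonneg.mpr hn'.le), mul_sub, inv_mul_cancel_left₀ hn'.ne']
      _ ≤ _ := by gcongr
  have hex : ∀ x, ∃ u, Tendsto (fun n : ℕ => (n : ℝ)⁻¹ • f ((n : ℝ) • x))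
      (hyperfilter ℕ) (𝓝 u) := by
    intro x
    obtain ⟨u, -, hu⟩ := (isCompact_closedBall (0 : E) (‖x‖ + C)).ultrafilter_le_nhds
      ((hyperfilter ℕ).map (fun n : ℕ => (n : ℝ)⁻¹ • f ((n : ℝ) • x))) (by
        rw [le_principal_iff, Ultrafilter.coe_map, mem_map]
        filter_upwards [hpos] with n hn
        have h := (abs_le.mp (hdist x 0 n hn)).2
        simp only [smul_zero, hf0, dist_zero_right] at h
        have h1 : (n : ℝ)⁻¹ * C ≤ C :=
          mul_le_of_le_one_left hC (inv_le_one_of_one_le₀ (by exact_mod_cast hn))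
        rw [Set.mem_preimage, mem_closedBall_zero_iff]
        linarith)
    exact ⟨u, hu⟩
  choose U hU using hex
  refine ⟨U, Isometry.of_dist_eq fun x y => ?_, ?_, hU⟩
  · have h1 : Tendsto (fun n : ℕ => (n : ℝ)⁻¹ * C) (hyperfilter ℕ) (𝓝 (0 * C)) :=
      (tendsto_inv_atTop_nhds_zero_nat.mono_left Nat.hyperfilter_le_atTop).mul_const C
    have h2 := (((hU x).dist (hU y)).sub_const (dist x y)).abs
    have h3 := le_of_tendsto_of_tendsto h2 h1 (by
      filter_upwards [hpos] with n hn using hdist x y n hn)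
    rw [zero_mul] at h3
    exact sub_eq_zero.mp (abs_nonpos_iff.mp h3)
  · have h := hU 0
    simp only [smul_zero, hf0] at h
    exact tendsto_nhds_unique h tendsto_const_nhds

open Filter Topology in
/-- An almost-isometry of a Euclidean space fixing the origin is at bounded distance from a linear
isometry. -/
theorem exists_linearIsometryEquiv_norm_sub_le {E : Type*} [NormedAddCommGroup E]
    [InnerProductSpace ℝ E] [FiniteDimensional ℝ E] {C : ℝ} {f : E → E} (hf0 : f 0 = 0)
    (hf : ∀ x y, |dist (f x) (f y) - dist x y| ≤ C) :
    ∃ U : E ≃ₗᵢ[ℝ] E, ∀ x, ‖f x - U x‖ ≤ 2 * C := by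
  have hC : 0 ≤ C := (abs_nonneg _).trans (hf 0 0)
  have : ProperSpace E := FiniteDimensional.proper_real E
  obtain ⟨V, hViso, hV0, hV⟩ := exists_isometry_tendsto_inv_smul hf0 hf
  let U : E ≃ₗᵢ[ℝ] E :=
    hViso.affineIsometryOfStrictConvexSpace.linearIsometry.toLinearIsometryEquiv rfl
  have hUV : ∀ x, U x = V x := fun x => by
    have h := hViso.affineIsometryOfStrictConvexSpace.map_vsub x 0
    simp only [vsub_eq_sub, sub_zero, Isometry.coe_affineIsometryOfStrictConvexSpace, hV0] at h
    exact h
  have key : ∀ x u, ‖u‖ = 1 → |inner ℝ (f x - U x) (U u)| ≤ 2 * C := by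
    intro x u hu
    have h1 := tendsto_norm_sub_smul_sub_norm_smul Nat.hyperfilter_le_atTop (hV u)
      (by rw [← hUV, U.norm_map, hu]) (f x)
    have h2 := tendsto_norm_sub_smul_sub_norm_smul (l := hyperfilter ℕ)
      Nat.hyperfilter_le_atTop (tendsto_const_nhds (x := u)) hu x
    have h3 : |(-inner ℝ (f x) (V u)) - (-inner ℝ x u)| ≤ 2 * C := by
      refine le_of_tendsto (h1.sub h2).abs ?_
      filter_upwards [Nat.hyperfilter_le_atTop (eventually_gt_atTop 0)] with n hn
      have hn' : (n : ℝ) ≠ 0 := Nat.cast_ne_zero.mpr (Nat.pos_iff_ne_zero.mp hn)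
      have ha := abs_le.mp (hf x ((n : ℝ) • u))
      have hb := abs_le.mp (hf ((n : ℝ) • u) 0)
      rw [hf0, dist_zero_right, dist_zero_right] at hb
      rw [dist_eq_norm, dist_eq_norm] at ha
      rw [smul_inv_smul₀ hn', abs_le]
      constructor <;> linarith [ha.1, ha.2, hb.1, hb.2]
    rw [inner_sub_left, U.inner_map_map, hUV]
    rwa [neg_sub_neg, abs_sub_comm] at h3
  refine ⟨U, fun x => ?_⟩
  by_cases hz : f x - U x = 0
  · rw [hz, norm_zero]
    positivity
  · have h := key x (U.symm (‖f x - U x‖⁻¹ • (f x - U x)))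
      (by rw [U.symm.norm_map, norm_smul, norm_inv, norm_norm,
        inv_mul_cancel₀ (norm_ne_zero_iff.mpr hz)])
    rw [U.apply_symm_apply, real_inner_smul_right, real_inner_self_eq_norm_sq, pow_two,
      inv_mul_cancel_left₀ (norm_ne_zero_iff.mpr hz), abs_norm] at h
    exact h

/-- Every C-almost-isometry of the Euclidean plane lies at bounded distance from a
bijective isometry of the plane. -/
theorem stmt_4 (C : ℝ) (hC : 0 ≤ C)
    (φ : EuclideanSpace ℝ (Fin 2) → EuclideanSpace ℝ (Fin 2))
    (hai : ∀ x₁ x₂ : EuclideanSpace ℝ (Fin 2),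
      dist x₁ x₂ - C ≤ dist (φ x₁) (φ x₂) ∧ dist (φ x₁) (φ x₂) ≤ dist x₁ x₂ + C)
    (honto : ∀ y : EuclideanSpace ℝ (Fin 2), ∃ x : EuclideanSpace ℝ (Fin 2),
      dist (φ x) y ≤ C) :
    ∃ I : EuclideanSpace ℝ (Fin 2) → EuclideanSpace ℝ (Fin 2),
      Function.Bijective I ∧ (∀ x y : EuclideanSpace ℝ (Fin 2), dist (I x) (I y) = dist x y) ∧
      ∃ B : ℝ, ∀ x : EuclideanSpace ℝ (Fin 2), ‖φ x - I x‖ ≤ B := by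
  obtain ⟨U, hU⟩ := exists_linearIsometryEquiv_norm_sub_le (f := fun x => φ x - φ 0) (C := C)
    (sub_self _) (fun x y => by
      rw [dist_sub_right, abs_le]
      constructor <;> linarith [(hai x y).1, (hai x y).2])
  refine ⟨fun x => U x + φ 0, (Equiv.addRight (φ 0)).bijective.comp U.bijective, fun x y => ?_,
    2 * C, fun x => ?_⟩
  · rw [dist_add_right, U.dist_map]
  · change ‖φ x - (U x + φ 0)‖ ≤ 2 * C
    rw [add_comm (U x), ← sub_sub]
    exact hU x
end

section
/- Let 0 < λ < 1, K ≥ 0, r₀ > 0, and let α : ℝ → ℝ be a function such that α(r) → 0 as r → ∞ and |α(r) − α(λ·r)| ≤ K/r for every r ≥ r₀. Then |α(r)| ≤ K/(r·(1−λ)) for every r ≥ r₀. -/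
/-- Partial sums of the telescoping series along the sequence `l⁻ⁿ r`. -/
theorem abs_sub_le_of_abs_sub_mul_le {l K r₀ : ℝ} (hl₀ : 0 < l) (hl₁ : l < 1) (hK : 0 ≤ K)
    (hr₀ : 0 < r₀) {α : ℝ → ℝ} (hdiff : ∀ r : ℝ, r₀ ≤ r → |α r - α (l * r)| ≤ K / r)
    {r : ℝ} (hr : r₀ ≤ r) (n : ℕ) :
    |α (r * l⁻¹ ^ n) - α r| ≤ K / (r * (1 - l)) * (1 - l ^ n) := by
  have hr' : 0 < r := hr₀.trans_le hr
  have h1l : 0 < 1 - l := sub_pos.2 hl₁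
  induction n with
  | zero => simp
  | succ n ih =>
    have hs : r₀ ≤ r * l⁻¹ ^ (n + 1) :=
      hr.trans (le_mul_of_one_le_right hr'.le (one_le_pow₀ ((one_le_inv₀ hl₀).2 hl₁.le)))
    have hd := hdiff _ hs
    have hmul : l * (r * l⁻¹ ^ (n + 1)) = r * l⁻¹ ^ n := by
      rw [pow_succ]
      field_simp
    have hdiv : K / (r * l⁻¹ ^ (n + 1)) = K / r * l ^ n * l := by
      rw [inv_pow, pow_succ]
      field_simp
    have hle : K / r * l ^ n * l ≤ K / r * l ^ n :=
      mul_le_of_le_one_right (by positivity) hl₁.le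
    have hsum : K / (r * (1 - l)) * (1 - l ^ (n + 1)) =
        K / r * l ^ n + K / (r * (1 - l)) * (1 - l ^ n) := by
      rw [pow_succ]
      field_simp
      ring
    rw [hmul, hdiv] at hd
    linarith [abs_sub_le (α (r * l⁻¹ ^ (n + 1))) (α (r * l⁻¹ ^ n)) (α r)]

/-- The telescoping estimate: if α(r) → 0 as r → ∞ and |α(r) − α(λr)| ≤ K/r for r ≥ r₀
(with 0 < λ < 1), then |α(r)| ≤ K/(r(1−λ)) for all r ≥ r₀. -/
theorem stmt_5 (l K r₀ : ℝ) (hl₀ : 0 < l) (hl₁ : l < 1) (hK : 0 ≤ K) (hr₀ : 0 < r₀)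
    (α : ℝ → ℝ) (hlim : Filter.Tendsto α Filter.atTop (nhds 0))
    (hdiff : ∀ r : ℝ, r₀ ≤ r → |α r - α (l * r)| ≤ K / r) :
    ∀ r : ℝ, r₀ ≤ r → |α r| ≤ K / (r * (1 - l)) := by
  intro r hr
  have hr' : 0 < r := hr₀.trans_le hr
  have h1l : 0 < 1 - l := sub_pos.2 hl₁
  have hseq : Filter.Tendsto (fun n : ℕ => r * l⁻¹ ^ n) Filter.atTop Filter.atTop :=
    (tendsto_pow_atTop_atTop_of_one_lt ((one_lt_inv₀ hl₀).2 hl₁)).const_mul_atTop hr'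
  have hα : Filter.Tendsto (fun n : ℕ => |α (r * l⁻¹ ^ n) - α r|) Filter.atTop
      (nhds |α r|) := by
    simpa using ((hlim.comp hseq).sub_const (α r)).abs
  refine le_of_tendsto' hα fun n => ?_
  refine (abs_sub_le_of_abs_sub_mul_le hl₀ hl₁ hK hr₀ hdiff hr n).trans ?_
  exact mul_le_of_le_one_right (by positivity) (by linarith [pow_pos hl₀ n])
end

section
/- Let (X,d_X) and (Y,d_Y) be metric spaces, C ≥ 0 and L ≥ 0, and let φ : X → Y and ψ : Y → X be coarse inverse C-almost-isometries. Let g₁ and g₂ be bijective isometries of X, and let I₁, I₂, I₁₂ be maps Y → Y such that I₁ is an isometry of Y and, for all y ∈ Y, d_Y((φ ∘ g₁ ∘ ψ)(y), I₁ y) ≤ L, d_Y((φ ∘ g₂ ∘ ψ)(y), I₂ y) ≤ L, and d_Y((φ ∘ (g₁ ∘ g₂) ∘ ψ)(y), I₁₂ y) ≤ L. Then for every y ∈ Y, d_Y(I₁₂ y, I₁(I₂ y)) ≤ 2C + 3L. -/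
/-- Straightening the pushed-forward action to isometries of Y gives a homomorphism up
to bounded error: d(I₁₂ y, I₁ (I₂ y)) ≤ 2C + 3L. -/
theorem stmt_8 {X Y : Type*} [MetricSpace X] [MetricSpace Y]
    (C L : ℝ) (hC : 0 ≤ C) (hL : 0 ≤ L) (φ : X → Y) (ψ : Y → X)
    (hφ : ∀ x₁ x₂ : X, dist x₁ x₂ - C ≤ dist (φ x₁) (φ x₂) ∧
      dist (φ x₁) (φ x₂) ≤ dist x₁ x₂ + C)
    (hψ : ∀ y₁ y₂ : Y, dist y₁ y₂ - C ≤ dist (ψ y₁) (ψ y₂) ∧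
      dist (ψ y₁) (ψ y₂) ≤ dist y₁ y₂ + C)
    (hψφ : ∀ x : X, dist (ψ (φ x)) x ≤ C)
    (hφψ : ∀ y : Y, dist (φ (ψ y)) y ≤ C)
    (g₁ g₂ : X → X) (hg₁ : Function.Bijective g₁) (hg₂ : Function.Bijective g₂)
    (hg₁iso : ∀ x₁ x₂ : X, dist (g₁ x₁) (g₁ x₂) = dist x₁ x₂)
    (hg₂iso : ∀ x₁ x₂ : X, dist (g₂ x₁) (g₂ x₂) = dist x₁ x₂)
    (I₁ I₂ I₁₂ : Y → Y)
    (hI₁iso : ∀ y₁ y₂ : Y, dist (I₁ y₁) (I₁ y₂) = dist y₁ y₂)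
    (hI₁ : ∀ y : Y, dist ((φ ∘ g₁ ∘ ψ) y) (I₁ y) ≤ L)
    (hI₂ : ∀ y : Y, dist ((φ ∘ g₂ ∘ ψ) y) (I₂ y) ≤ L)
    (hI₁₂ : ∀ y : Y, dist ((φ ∘ (g₁ ∘ g₂) ∘ ψ) y) (I₁₂ y) ≤ L) :
    ∀ y : Y, dist (I₁₂ y) (I₁ (I₂ y)) ≤ 2 * C + 3 * L := by
  intro y
  set z : Y := φ (g₂ (ψ y))
  have h₁₂ : dist (I₁₂ y) (φ (g₁ (g₂ (ψ y)))) ≤ L := by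
    rw [dist_comm]
    exact hI₁₂ y
  have hmid : dist (φ (g₁ (g₂ (ψ y)))) (φ (g₁ (ψ z))) ≤ 2 * C := by
    have h := (hφ (g₁ (g₂ (ψ y))) (g₁ (ψ z))).2
    rw [hg₁iso, dist_comm (g₂ (ψ y))] at h
    linarith [hψφ (g₂ (ψ y))]
  have h₁ : dist (φ (g₁ (ψ z))) (I₁ z) ≤ L := hI₁ z
  have h₂ : dist (I₁ z) (I₁ (I₂ y)) ≤ L := by
    rw [hI₁iso]
    exact hI₂ y
  linarith [dist_triangle4 (I₁₂ y) (φ (g₁ (g₂ (ψ y)))) (φ (g₁ (ψ z))) (I₁ z),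
    dist_triangle (I₁₂ y) (I₁ z) (I₁ (I₂ y))]
end

section
/- Let (X,d_X) and (Y,d_Y) be metric spaces, C ≥ 0, L ≥ 0, D ≥ 0, and let φ : X → Y and ψ : Y → X be coarse inverse C-almost-isometries. Let g be a bijective isometry of X and I an isometry of Y such that d_Y((φ ∘ g ∘ ψ)(z), I z) ≤ L for all z ∈ Y. Suppose y, y₀ ∈ Y satisfy d_Y(y₀, y) ≤ D and d_Y(I y, y) ≤ D. Then d_X(g(ψ y), ψ y₀) ≤ L + 2D + 5C. -/
/-- Displacement estimate used in properness of the straightened action: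
if d(y₀, y) ≤ D and d(I y, y) ≤ D then d(g (ψ y), ψ y₀) ≤ L + 2D + 5C. -/
theorem stmt_10 {X Y : Type*} [MetricSpace X] [MetricSpace Y]
    (C L D : ℝ) (hC : 0 ≤ C) (hL : 0 ≤ L) (hD : 0 ≤ D) (φ : X → Y) (ψ : Y → X)
    (hφ : ∀ x₁ x₂ : X, dist x₁ x₂ - C ≤ dist (φ x₁) (φ x₂) ∧
      dist (φ x₁) (φ x₂) ≤ dist x₁ x₂ + C)
    (hψ : ∀ y₁ y₂ : Y, dist y₁ y₂ - C ≤ dist (ψ y₁) (ψ y₂) ∧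
      dist (ψ y₁) (ψ y₂) ≤ dist y₁ y₂ + C)
    (hψφ : ∀ x : X, dist (ψ (φ x)) x ≤ C)
    (hφψ : ∀ y : Y, dist (φ (ψ y)) y ≤ C)
    (g : X → X) (hg : Function.Bijective g)
    (hgiso : ∀ x₁ x₂ : X, dist (g x₁) (g x₂) = dist x₁ x₂)
    (I : Y → Y) (hIiso : ∀ y₁ y₂ : Y, dist (I y₁) (I y₂) = dist y₁ y₂)
    (hI : ∀ z : Y, dist ((φ ∘ g ∘ ψ) z) (I z) ≤ L)
    (y y₀ : Y) (hy₀ : dist y₀ y ≤ D) (hIy : dist (I y) y ≤ D) :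
    dist (g (ψ y)) (ψ y₀) ≤ L + 2 * D + 5 * C := by
  have h_lower := (hφ (g (ψ y)) (ψ y₀)).1
  have h_straighten : dist (φ (g (ψ y))) (I y) ≤ L := hI y
  have h_triangle : dist (φ (g (ψ y))) (φ (ψ y₀)) ≤ L + D + D + C := by
    have h₁ := dist_triangle4 (φ (g (ψ y))) (I y) y (φ (ψ y₀))
    have h₂ := dist_triangle_right y (φ (ψ y₀)) y₀
    have h₃ := hφψ y₀
    rw [dist_comm y y₀] at h₂
    linarith
  linarith
end

section
/- Let (X,d_X) and (Y,d_Y) be metric spaces, C ≥ 0, and let φ : X → Y be C-almost-isometric and C-coarsely onto. Fix p ∈ X, r ≥ 0, u > 0, and a finite set S ⊆ X such that the closed ball of radius r about p is covered: closedBall(p, r) ⊆ ⋃_{s∈S} closedBall(s, u). Then the closed ball of radius r − 2C about φ(p) in Y is covered by the closed balls of radius u + 2C about the images: closedBall(φ p, r − 2C) ⊆ ⋃_{s∈S} closedBall(φ s, u + 2C). -/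
/-- Covering-transfer estimate: a C-almost-isometry maps an (u)-ball covering of the
r-ball about p to a (u+2C)-ball covering of the (r−2C)-ball about φ p. -/
theorem stmt_15 {X Y : Type*} [MetricSpace X] [MetricSpace Y]
    (C : ℝ) (hC : 0 ≤ C) (φ : X → Y)
    (hai : ∀ x₁ x₂ : X, dist x₁ x₂ - C ≤ dist (φ x₁) (φ x₂) ∧
      dist (φ x₁) (φ x₂) ≤ dist x₁ x₂ + C)
    (honto : ∀ y : Y, ∃ x : X, dist (φ x) y ≤ C)
    (p : X) (r u : ℝ) (hr : 0 ≤ r) (hu : 0 < u) (S : Finset X)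
    (hcover : Metric.closedBall p r ⊆ ⋃ s ∈ S, Metric.closedBall s u) :
    Metric.closedBall (φ p) (r - 2 * C) ⊆ ⋃ s ∈ S, Metric.closedBall (φ s) (u + 2 * C) := by
  intro y hy
  obtain ⟨x, hxy⟩ := honto y
  rw [Metric.mem_closedBall] at hy
  have hx : x ∈ Metric.closedBall p r := by
    rw [Metric.mem_closedBall]
    linarith [(hai x p).1, dist_triangle (φ x) y (φ p)]
  obtain ⟨s, hs, hxs⟩ := Set.mem_iUnion₂.mp (hcover hx)
  rw [Metric.mem_closedBall] at hxs
  refine Set.mem_iUnion₂.mpr ⟨s, hs, ?_⟩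
  rw [Metric.mem_closedBall]
  linarith [(hai x s).2, dist_triangle_left y (φ s) (φ x)]
end

section
/- Let X and Y be metric spaces equipped with their Borel σ-algebras, let s ≥ 0, and let μ_X and μ_Y denote the s-dimensional Hausdorff measures on X and Y respectively. Assume that for every ρ > 0 there exist real constants 0 < v ≤ V < ∞ such that v ≤ μ_X(closedBall(x, ρ)) ≤ V for all x ∈ X and v ≤ μ_Y(closedBall(y, ρ)) ≤ V for all y ∈ Y. Suppose there exist C ≥ 0 and a C-almost-isometry φ : X → Y. Then for every p ∈ X and q ∈ Y: limsup_{r→∞} log(μ_X(closedBall(p, r)))/r = limsup_{r→∞} log(μ_Y(closedBall(q, r)))/r, and liminf_{r→∞} log(μ_X(closedBall(p, r)))/r = liminf_{r→∞} log(μ_Y(closedBall(q, r)))/r (where the measures of balls, which are finite and positive by hypothesis, are interpreted as real numbers). -/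
open MeasureTheory

/-- Two sets of reals each of which contains every translate `a + ε` of the points of the other
have the same infimum (including the junk values for empty and unbounded sets). -/
theorem Real.sInf_eq_of_forall_add_mem {S T : Set ℝ}
    (hST : ∀ a ∈ S, ∀ ε > 0, a + ε ∈ T) (hTS : ∀ a ∈ T, ∀ ε > 0, a + ε ∈ S) :
    sInf S = sInf T := by
  have bdd : ∀ {S T : Set ℝ}, (∀ a ∈ T, ∀ ε > 0, a + ε ∈ S) → BddBelow S → BddBelow T := by
    rintro S T h ⟨b, hb⟩
    refine ⟨b - 1, fun a ha => ?_⟩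
    linarith [hb (h a ha 1 one_pos)]
  have le : ∀ {S T : Set ℝ}, (∀ a ∈ T, ∀ ε > 0, a + ε ∈ S) → BddBelow S → T.Nonempty →
      sInf S ≤ sInf T := fun {S T} h hS hT =>
    le_csInf hT fun a ha => le_of_forall_pos_le_add fun ε hε => csInf_le hS (h a ha ε hε)
  rcases S.eq_empty_or_nonempty with rfl | ⟨a, ha⟩
  · rcases T.eq_empty_or_nonempty with rfl | ⟨b, hb⟩
    · rfl
    · exact (hTS b hb 1 one_pos).elim
  by_cases hS : BddBelow S
  · exact (le hTS hS ⟨_, hST a ha 1 one_pos⟩).antisymm (le hST (bdd hTS hS) ⟨a, ha⟩)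
  · rw [Real.sInf_of_not_bddBelow hS, Real.sInf_of_not_bddBelow fun hT => hS (bdd hST hT)]

theorem Real.sSup_eq_of_forall_sub_mem {S T : Set ℝ}
    (hST : ∀ a ∈ S, ∀ ε > 0, a - ε ∈ T) (hTS : ∀ a ∈ T, ∀ ε > 0, a - ε ∈ S) :
    sSup S = sSup T := by
  have h := Real.sInf_eq_of_forall_add_mem (S := -S) (T := -T)
    (fun a ha ε hε => by simpa [sub_eq_add_neg, add_comm] using hST _ ha ε hε)
    (fun a ha ε hε => by simpa [sub_eq_add_neg, add_comm] using hTS _ ha ε hε)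
  rwa [Real.sInf_neg, Real.sInf_neg, neg_inj] at h

open Filter in
theorem eventually_div_le_add {f g : ℝ → ℝ} {k c : ℝ} (hfg : ∀ r > 0, f r ≤ g (r + c) + k)
    {a ε : ℝ} (hε : 0 < ε) (hg : ∀ᶠ r in atTop, g r / r ≤ a) :
    ∀ᶠ r in atTop, f r / r ≤ a + ε := by
  filter_upwards [(tendsto_atTop_add_const_right atTop c tendsto_id).eventually hg,
    (tendsto_atTop_add_const_right atTop c tendsto_id).eventually (eventually_gt_atTop 0),
    eventually_gt_atTop 0, eventually_ge_atTop ((a * c + k) / ε)] with r h1 h2 h3 h4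
  simp only [id] at h1 h2
  rw [div_le_iff₀ h2] at h1
  rw [div_le_iff₀ hε] at h4
  rw [div_le_iff₀ h3]
  nlinarith [hfg r h3]

open Filter in
theorem eventually_sub_le_div {f g : ℝ → ℝ} {k c : ℝ} (hfg : ∀ r > 0, f r ≤ g (r + c) + k)
    {a ε : ℝ} (hε : 0 < ε) (hf : ∀ᶠ r in atTop, a ≤ f r / r) :
    ∀ᶠ r in atTop, a - ε ≤ g r / r := by
  filter_upwards [(tendsto_atTop_add_const_right atTop (-c) tendsto_id).eventually hf,
    (tendsto_atTop_add_const_right atTop (-c) tendsto_id).eventually (eventually_gt_atTop 0),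
    eventually_gt_atTop 0, eventually_ge_atTop ((a * c + k) / ε)] with r h1 h2 h3 h4
  simp only [id] at h1 h2
  rw [le_div_iff₀ h2] at h1
  rw [div_le_iff₀ hε] at h4
  rw [le_div_iff₀ h3]
  have h5 := hfg _ h2
  rw [neg_add_cancel_right] at h5
  nlinarith

open Filter in
/-- Functions that bound each other up to bounded shifts of argument and value have the same
upper and lower linear growth rates. -/
theorem limsup_div_eq_and_liminf_div_eq {f g : ℝ → ℝ} {k c k' c' : ℝ}
    (hfg : ∀ r > 0, f r ≤ g (r + c) + k) (hgf : ∀ r > 0, g r ≤ f (r + c') + k') :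
    limsup (fun r => f r / r) atTop = limsup (fun r => g r / r) atTop ∧
      liminf (fun r => f r / r) atTop = liminf (fun r => g r / r) atTop := by
  simp only [limsup_eq, liminf_eq]
  exact ⟨Real.sInf_eq_of_forall_add_mem
      (fun _ ha _ hε => eventually_div_le_add hgf hε ha)
      (fun _ ha _ hε => eventually_div_le_add hfg hε ha),
    Real.sSup_eq_of_forall_sub_mem
      (fun _ ha _ hε => eventually_sub_le_div hfg hε ha)
      (fun _ ha _ hε => eventually_sub_le_div hgf hε ha)⟩

open Metric in
/-- Comparing measures of sets by packing in the target and covering in the source. -/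
theorem measure_mul_le_of_separated {X Y : Type*} [MetricSpace X] [MeasurableSpace X]
    [MetricSpace Y] [MeasurableSpace Y] [BorelSpace Y] (μ : Measure X) (ν : Measure Y)
    {φ : X → Y} {A : Set X} {B : Set Y} {δ : NNReal} {ρ : ℝ} {v V : ENNReal}
    (hv : v ≠ 0) (hB : ν B ≠ ⊤) (hμ : ∀ x, μ (closedBall x δ) ≤ V)
    (hν : ∀ y, v ≤ ν (closedBall y ρ)) (hAB : ∀ x ∈ A, closedBall (φ x) ρ ⊆ B)
    (hsep : ∀ x x', δ < dist x x' → 2 * ρ < dist (φ x) (φ x')) :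
    μ A * v ≤ V * ν B := by
  have pack : ∀ t : Finset X, ↑t ⊆ A → IsSeparated δ (t : Set X) → t.card * v ≤ ν B := by
    intro t htA ht
    have hd : (t : Set X).PairwiseDisjoint fun x => closedBall (φ x) ρ := by
      intro x hx y hy hxy
      refine closedBall_disjoint_closedBall ?_
      have h : (δ : ENNReal) < edist x y := ht hx hy hxy
      rw [edist_nndist, ENNReal.coe_lt_coe, ← NNReal.coe_lt_coe, coe_nndist] at h
      linarith [hsep x y h]
    calc t.card * v = ∑ _x ∈ t, v := by simp
      _ ≤ ∑ x ∈ t, ν (closedBall (φ x) ρ) := Finset.sum_le_sum fun x _ => hν _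
      _ = ν (⋃ x ∈ t, closedBall (φ x) ρ) :=
        (measure_biUnion_finset hd fun x _ => isClosed_closedBall.measurableSet).symm
      _ ≤ ν B := measure_mono (Set.iUnion₂_subset fun x hx => hAB x (htA hx))
  obtain ⟨N, hN⟩ : ∃ N : ℕ, ν B < N * v := ENNReal.exists_nat_mul_gt hv hB
  have hpack : packingNumber δ A ≠ ⊤ := by
    refine ne_top_of_le_ne_top (ENat.natCast_ne_top N) (iSup₂_le fun S hSA => iSup_le fun hS => ?_)
    by_contra! h
    obtain ⟨T, hTS, hT⟩ := Set.exists_subset_encard_eq h.le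
    have hfin : T.Finite := Set.finite_of_encard_eq_coe hT
    lift T to Finset X using hfin
    rw [Set.encard_coe_eq_coe_finsetCard, Nat.cast_inj] at hT
    have := pack T (hTS.trans hSA) (hS.subset hTS)
    rw [hT] at this
    exact hN.not_ge this
  have hcov := isCover_maximalSeparatedSet hpack
  have hfin : (maximalSeparatedSet δ A).Finite := by
    rw [← Set.encard_ne_top_iff, encard_maximalSeparatedSet hpack]
    exact hpack
  have hsub : maximalSeparatedSet δ A ⊆ A := maximalSeparatedSet_subset
  have hsp := isSeparated_maximalSeparatedSet (ε := δ) (A := A)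
  generalize maximalSeparatedSet δ A = T at *
  lift T to Finset X using hfin
  calc μ A * v ≤ (∑ x ∈ T, μ (closedBall x δ)) * v := by
        gcongr
        refine (measure_mono ?_).trans (measure_biUnion_finset_le T _)
        simpa using isCover_iff_subset_iUnion_closedBall.1 hcov
    _ ≤ (∑ _x ∈ T, V) * v := by gcongr; exact hμ _
    _ = V * (T.card * v) := by simp only [Finset.sum_const, nsmul_eq_mul]; ring
    _ ≤ V * ν B := by gcongr; exact pack T hsub hsp

open Metric in
/-- Under two-sided uniform bounds on the measures of balls, a map that distorts distances by a
bounded amount controls the logarithmic volume of balls in the source by that in the target. -/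
theorem exists_log_measure_closedBall_le {X Y : Type*} [MetricSpace X] [MeasurableSpace X]
    [MetricSpace Y] [MeasurableSpace Y] [BorelSpace Y] (μ : Measure X) (ν : Measure Y)
    (hμ : ∀ ρ : ℝ, 0 < ρ → ∃ v V : ℝ, 0 < v ∧ v ≤ V ∧ ∀ x : X,
      ENNReal.ofReal v ≤ μ (closedBall x ρ) ∧ μ (closedBall x ρ) ≤ ENNReal.ofReal V)
    (hν : ∀ ρ : ℝ, 0 < ρ → ∃ v V : ℝ, 0 < v ∧ v ≤ V ∧ ∀ y : Y,
      ENNReal.ofReal v ≤ ν (closedBall y ρ) ∧ ν (closedBall y ρ) ≤ ENNReal.ofReal V)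
    {C : ℝ} (hC : 0 ≤ C) {φ : X → Y}
    (hφ : ∀ x₁ x₂, dist x₁ x₂ - C ≤ dist (φ x₁) (φ x₂) ∧ dist (φ x₁) (φ x₂) ≤ dist x₁ x₂ + C)
    (p : X) (q : Y) :
    ∃ k c : ℝ, ∀ r > 0, Real.log (μ (closedBall p r)).toReal ≤
      Real.log (ν (closedBall q (r + c))).toReal + k := by
  obtain ⟨_, V, hvV₀, hV₀, hV⟩ := hμ (C + 2) (by linarith)
  obtain ⟨v, _, hv₀, -, hv⟩ := hν 1 one_pos
  have hVpos : 0 < V := hvV₀.trans_le hV₀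
  refine ⟨Real.log V - Real.log v, C + dist (φ p) q + 1, fun r hr => ?_⟩
  obtain ⟨w, W, hw, -, hwW⟩ := hμ r hr
  have hr' : 0 < r + (C + dist (φ p) q + 1) := by positivity
  obtain ⟨w', W', hw', -, hwW'⟩ := hν _ hr'
  have hBtop := ne_top_of_le_ne_top ENNReal.ofReal_ne_top (hwW' q).2
  have hAtop := ne_top_of_le_ne_top ENNReal.ofReal_ne_top (hwW p).2
  have hA : 0 < (μ (closedBall p r)).toReal :=
    ENNReal.toReal_pos ((ENNReal.ofReal_pos.2 hw).trans_le (hwW p).1).ne' hAtop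
  have hB : 0 < (ν (closedBall q (r + (C + dist (φ p) q + 1)))).toReal :=
    ENNReal.toReal_pos ((ENNReal.ofReal_pos.2 hw').trans_le (hwW' q).1).ne' hBtop
  have key := measure_mul_le_of_separated μ ν (φ := φ) (A := closedBall p r)
    (δ := ⟨C + 2, by linarith⟩) (ρ := 1) (ENNReal.ofReal_pos.2 hv₀).ne' hBtop
    (fun x => (hV x).2) (fun y => (hv y).1)
    (fun x hx => closedBall_subset_closedBall' (by
      linarith [dist_triangle (φ x) (φ p) q, (hφ x p).2, mem_closedBall.1 hx]))
    (fun x x' (h : C + 2 < dist x x') => by linarith [(hφ x x').1])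
  have key' := ENNReal.toReal_mono (ENNReal.mul_ne_top ENNReal.ofReal_ne_top hBtop) key
  rw [ENNReal.toReal_mul, ENNReal.toReal_mul, ENNReal.toReal_ofReal hv₀.le,
    ENNReal.toReal_ofReal hVpos.le] at key'
  have := Real.log_le_log (mul_pos hA hv₀) key'
  rw [Real.log_mul hA.ne' hv₀.ne', Real.log_mul hVpos.ne' hB.ne'] at this
  linarith


/-- Almost-isometric metric spaces with two-sided bounds on the s-dimensional Hausdorff
measure of balls have the same upper and lower exponential volume growth rates. -/
theorem stmt_16 {X Y : Type*} [MetricSpace X] [MeasurableSpace X] [BorelSpace X]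
    [MetricSpace Y] [MeasurableSpace Y] [BorelSpace Y] (s : ℝ) (hs : 0 ≤ s)
    (hXbd : ∀ ρ : ℝ, 0 < ρ → ∃ v V : ℝ, 0 < v ∧ v ≤ V ∧
      ∀ x : X, ENNReal.ofReal v ≤ μH[s] (Metric.closedBall x ρ) ∧
        μH[s] (Metric.closedBall x ρ) ≤ ENNReal.ofReal V)
    (hYbd : ∀ ρ : ℝ, 0 < ρ → ∃ v V : ℝ, 0 < v ∧ v ≤ V ∧
      ∀ y : Y, ENNReal.ofReal v ≤ μH[s] (Metric.closedBall y ρ) ∧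
        μH[s] (Metric.closedBall y ρ) ≤ ENNReal.ofReal V)
    (C : ℝ) (hC : 0 ≤ C) (φ : X → Y)
    (hai : ∀ x₁ x₂ : X, dist x₁ x₂ - C ≤ dist (φ x₁) (φ x₂) ∧
      dist (φ x₁) (φ x₂) ≤ dist x₁ x₂ + C)
    (honto : ∀ y : Y, ∃ x : X, dist (φ x) y ≤ C) :
    ∀ (p : X) (q : Y),
      (Filter.limsup (fun r : ℝ => Real.log ((μH[s] (Metric.closedBall p r)).toReal) / r)
          Filter.atTop =
        Filter.limsup (fun r : ℝ => Real.log ((μH[s] (Metric.closedBall q r)).toReal) / r)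
          Filter.atTop) ∧
      (Filter.liminf (fun r : ℝ => Real.log ((μH[s] (Metric.closedBall p r)).toReal) / r)
          Filter.atTop =
        Filter.liminf (fun r : ℝ => Real.log ((μH[s] (Metric.closedBall q r)).toReal) / r)
          Filter.atTop) := by
  intro p q
  choose ψ hψ using honto
  have hψ' : ∀ y₁ y₂, dist y₁ y₂ - 3 * C ≤ dist (ψ y₁) (ψ y₂) ∧
      dist (ψ y₁) (ψ y₂) ≤ dist y₁ y₂ + 3 * C := by
    intro y₁ y₂
    have h := hai (ψ y₁) (ψ y₂)
    have h₁ := dist_triangle4_right y₁ y₂ (φ (ψ y₁)) (φ (ψ y₂))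
    have h₂ := dist_triangle4_right (φ (ψ y₁)) (φ (ψ y₂)) y₁ y₂
    rw [dist_comm y₁ (φ _), dist_comm y₂ (φ _)] at h₁
    constructor <;> linarith [hψ y₁, hψ y₂]
  obtain ⟨k, c, hXY⟩ := exists_log_measure_closedBall_le _ _ hXbd hYbd hC hai p q
  obtain ⟨k', c', hYX⟩ :=
    exists_log_measure_closedBall_le _ _ hYbd hXbd (by positivity) hψ' q p
  exact limsup_div_eq_and_liminf_div_eq hXY hYX
end

section
/- Let X be a metric space equipped with its Borel σ-algebra, let s ≥ 0, and let μ denote the s-dimensional Hausdorff measure on X. Assume that for every ρ > 0 there exist real constants 0 < v ≤ V < ∞ such that v ≤ μ(closedBall(x, ρ)) ≤ V for all x ∈ X. Suppose there exist p ∈ X and a real number h > 0 such that log(μ(closedBall(p, r)))/r → h as r → ∞ (ball measures interpreted as real numbers). Let λ > 0 with λ ≠ 1, let Y be a metric space, and let e : X → Y be a bijection satisfying d_Y(e a, e b) = λ · d_X(a, b) for all a, b ∈ X. Then for no C ≥ 0 does there exist a C-almost-isometry φ : X → Y. -/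
open MeasureTheory

/-- Every subset of a metric space contains a maximal separated subset, which is then a net. -/
theorem exists_separated_net {X : Type*} [MetricSpace X] (A : Set X) (D : ℝ) (hD : 0 ≤ D) :
    ∃ N ⊆ A, N.Pairwise (fun a b => D < dist a b) ∧ A ⊆ ⋃ a ∈ N, Metric.closedBall a D := by
  obtain ⟨N, hN⟩ := zorn_subset {N : Set X | N ⊆ A ∧ N.Pairwise (fun a b => D < dist a b)} (by
    intro c hc hchain
    refine ⟨⋃₀ c, ⟨Set.sUnion_subset fun t ht => (hc ht).1, ?_⟩,
      fun t ht => Set.subset_sUnion_of_mem ht⟩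
    exact (Set.pairwise_sUnion hchain.directedOn).2 fun t ht => (hc ht).2)
  refine ⟨N, hN.prop.1, hN.prop.2, fun x hx => ?_⟩
  simp only [Set.mem_iUnion, Metric.mem_closedBall, exists_prop]
  by_contra! hfar
  have hmem : insert x N ∈ {N : Set X | N ⊆ A ∧ N.Pairwise (fun a b => D < dist a b)} := by
    refine ⟨Set.insert_subset hx hN.prop.1, hN.prop.2.insert fun b hb _ => ⟨hfar b hb, ?_⟩⟩
    rw [dist_comm]
    exact hfar b hb
  have hxN : x ∈ N := hN.le_of_ge hmem (Set.subset_insert x N) (Set.mem_insert x N)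
  have := hfar x hxN
  rw [dist_self] at this
  linarith

/-- A map distorting distances by a factor `m` up to an additive error `C` controls the measure
of a ball of radius `r` by that of a ball of radius `m * r` plus a constant. -/
theorem measure_closedBall_le_of_coarse_similarity {X : Type*} [MetricSpace X]
    [MeasurableSpace X] [BorelSpace X] (μ : Measure X) (m C : ℝ) (hm : 0 < m) (hC : 0 ≤ C)
    (ψ : X → X)
    (hψ : ∀ a b : X, m * dist a b - C ≤ dist (ψ a) (ψ b) ∧ dist (ψ a) (ψ b) ≤ m * dist a b + C)
    (v V : ENNReal) (hv : v ≠ 0) (hv1 : ∀ x, v ≤ μ (Metric.closedBall x 1))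
    (hV : ∀ x, μ (Metric.closedBall x ((C + 2) / m)) ≤ V) (p : X) (r : ℝ)
    (hfin : μ (Metric.closedBall p (m * r + (C + 1 + dist (ψ p) p))) ≠ ⊤) :
    v * μ (Metric.closedBall p r) ≤
      V * μ (Metric.closedBall p (m * r + (C + 1 + dist (ψ p) p))) := by
  obtain ⟨N, hNA, hsep, hcov⟩ :=
    exists_separated_net (Metric.closedBall p r) ((C + 2) / m) (by positivity)
  have hdisj : Pairwise (Function.onFun Disjoint
      fun a : N => Metric.closedBall (ψ (a : X)) 1) := by
    intro a b hab
    refine Metric.closedBall_disjoint_closedBall ?_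
    have h1 : (C + 2) / m < dist (a : X) b := hsep a.2 b.2 (fun h => hab (Subtype.ext h))
    have h2 := (hψ a b).1
    rw [div_lt_iff₀ hm] at h1
    linarith
  have hsub : (⋃ a : N, Metric.closedBall (ψ (a : X)) 1) ⊆
      Metric.closedBall p (m * r + (C + 1 + dist (ψ p) p)) := by
    refine Set.iUnion_subset fun a => Metric.closedBall_subset_closedBall' ?_
    have h1 := (hψ a p).2
    have h2 := mul_le_mul_of_nonneg_left (Metric.mem_closedBall.1 (hNA a.2)) hm.le
    have h3 := dist_triangle (ψ a) (ψ p) p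
    linarith
  have hpack : (N.encard : ENNReal) * v ≤
      μ (Metric.closedBall p (m * r + (C + 1 + dist (ψ p) p))) := by
    rw [← ENNReal.tsum_set_const]
    exact (ENNReal.tsum_le_tsum fun a => hv1 _).trans
      ((tsum_meas_le_meas_iUnion_of_disjoint μ
        (fun _ => Metric.isClosed_closedBall.measurableSet) hdisj).trans (measure_mono hsub))
  have hNfin : N.Finite := by
    by_contra hinf
    rw [Set.encard_eq_top hinf, ENat.toENNReal_top, ENNReal.top_mul hv] at hpack
    exact hfin (top_le_iff.1 hpack)
  have hcount : μ (Metric.closedBall p r) ≤ N.encard * V := by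
    rw [← ENNReal.tsum_set_const]
    exact (measure_mono hcov).trans ((measure_biUnion_le μ hNfin.countable _).trans
      (ENNReal.tsum_le_tsum fun a => hV _))
  calc v * μ (Metric.closedBall p r) ≤ v * (N.encard * V) := by gcongr
    _ = V * (N.encard * v) := by ring
    _ ≤ _ := by gcongr

/-- In a space of positive exponential volume growth, a map distorting distances by a factor `m`
up to an additive error cannot be contracting. -/
theorem one_le_of_coarse_similarity {X : Type*} [MetricSpace X]
    [MeasurableSpace X] [BorelSpace X] (μ : Measure X)
    (hbd : ∀ ρ : ℝ, 0 < ρ → ∃ v V : ℝ, 0 < v ∧ v ≤ V ∧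
      ∀ x : X, ENNReal.ofReal v ≤ μ (Metric.closedBall x ρ) ∧
        μ (Metric.closedBall x ρ) ≤ ENNReal.ofReal V)
    (p : X) (h : ℝ) (hh : 0 < h)
    (hgrowth : Filter.Tendsto
      (fun r : ℝ => Real.log ((μ (Metric.closedBall p r)).toReal) / r)
      Filter.atTop (nhds h))
    (m C : ℝ) (hm : 0 < m) (hC : 0 ≤ C) (ψ : X → X)
    (hψ : ∀ a b : X,
      m * dist a b - C ≤ dist (ψ a) (ψ b) ∧ dist (ψ a) (ψ b) ≤ m * dist a b + C) :
    1 ≤ m := by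
  obtain ⟨v, _, hv, _, hv1⟩ := hbd 1 one_pos
  obtain ⟨v', V, hv', hvV, hV⟩ := hbd ((C + 2) / m) (by positivity)
  have hVpos : 0 < V := hv'.trans_le hvV
  set K := C + 1 + dist (ψ p) p with hK
  set f : ℝ → ℝ := fun r => (μ (Metric.closedBall p r)).toReal with hf
  have hpos : ∀ᶠ r in Filter.atTop, 0 < f r := by
    filter_upwards [hgrowth.eventually (lt_mem_nhds hh)] with r hr
    refine ENNReal.toReal_nonneg.lt_of_ne fun h0 => ?_
    rw [← h0] at hr
    simp at hr
  have hshift : Filter.Tendsto (fun r : ℝ => m * r + K) Filter.atTop Filter.atTop :=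
    Filter.tendsto_atTop_add_const_right _ _ (Filter.tendsto_id.const_mul_atTop hm)
  have hinv (c : ℝ) : Filter.Tendsto (fun r : ℝ => c / r) Filter.atTop (nhds 0) :=
    Filter.tendsto_id.const_div_atTop c
  have hratio : Filter.Tendsto (fun r : ℝ => m + K / r) Filter.atTop (nhds m) := by
    simpa using (hinv K).const_add m
  have hlim : Filter.Tendsto
      (fun r : ℝ => Real.log (V / v) / r +
        Real.log (f (m * r + K)) / (m * r + K) * (m + K / r)) Filter.atTop (nhds (h * m)) := by
    simpa using (hinv (Real.log (V / v))).add ((hgrowth.comp hshift).mul hratio)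
  have hle : h ≤ h * m := by
    refine le_of_tendsto_of_tendsto hgrowth hlim ?_
    filter_upwards [hpos, hshift.eventually hpos, Filter.eventually_gt_atTop 0,
      hshift.eventually (Filter.eventually_gt_atTop 0)] with r hr hr' hr0 hs0
    have hfin := (ENNReal.toReal_pos_iff.1 hr').2.ne
    have hmain := measure_closedBall_le_of_coarse_similarity μ m C hm hC ψ hψ
      (ENNReal.ofReal v) (ENNReal.ofReal V) (by simpa using hv) (fun x => (hv1 x).1)
      (fun x => (hV x).2) p r hfin
    have hreal : v * f r ≤ V * f (m * r + K) := by
      have := ENNReal.toReal_mono (ENNReal.mul_ne_top ENNReal.ofReal_ne_top hfin) hmain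
      simpa [ENNReal.toReal_mul, ENNReal.toReal_ofReal, hv.le, hVpos.le] using this
    have hlog : Real.log (f r) ≤ Real.log (V / v) + Real.log (f (m * r + K)) := by
      rw [← Real.log_mul (by positivity) hr'.ne']
      refine Real.log_le_log hr ?_
      rw [div_mul_eq_mul_div, le_div_iff₀ hv]
      linarith
    calc Real.log (f r) / r
        ≤ (Real.log (V / v) + Real.log (f (m * r + K))) / r := by gcongr
      _ = _ := by
        have : m * r + K ≠ 0 := hs0.ne'
        field_simp
  exact (le_mul_iff_one_le_right hh).1 hle

/-- A metric space with two-sided Hausdorff-measure ball bounds and positive exponential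
volume growth rate is not almost-isometric to a nontrivial rescaling of itself. -/
theorem stmt_18 {X Y : Type*} [MetricSpace X] [MeasurableSpace X] [BorelSpace X]
    [MetricSpace Y] (s : ℝ) (hs : 0 ≤ s)
    (hbd : ∀ ρ : ℝ, 0 < ρ → ∃ v V : ℝ, 0 < v ∧ v ≤ V ∧
      ∀ x : X, ENNReal.ofReal v ≤ μH[s] (Metric.closedBall x ρ) ∧
        μH[s] (Metric.closedBall x ρ) ≤ ENNReal.ofReal V)
    (p : X) (h : ℝ) (hh : 0 < h)
    (hgrowth : Filter.Tendsto
      (fun r : ℝ => Real.log ((μH[s] (Metric.closedBall p r)).toReal) / r)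
      Filter.atTop (nhds h))
    (l : ℝ) (hl : 0 < l) (hl1 : l ≠ 1)
    (e : X → Y) (he : Function.Bijective e)
    (hescale : ∀ a b : X, dist (e a) (e b) = l * dist a b) :
    ∀ C : ℝ, 0 ≤ C → ¬ ∃ φ : X → Y,
      (∀ x₁ x₂ : X, dist x₁ x₂ - C ≤ dist (φ x₁) (φ x₂) ∧
        dist (φ x₁) (φ x₂) ≤ dist x₁ x₂ + C) ∧
      (∀ y : Y, ∃ x : X, dist (φ x) y ≤ C) := by
  rintro C hC ⟨φ, hφ, honto⟩
  choose g hg using he.surjective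
  choose χ hχ using fun x => honto (e x)
  have hforward : 1 ≤ l⁻¹ := by
    refine one_le_of_coarse_similarity _ hbd p h hh hgrowth l⁻¹ (l⁻¹ * C) (by positivity)
      (by positivity) (fun x => g (φ x)) fun a b => ?_
    have hd : dist (g (φ a)) (g (φ b)) = l⁻¹ * dist (φ a) (φ b) := by
      rw [eq_inv_mul_iff_mul_eq₀ hl.ne', ← hescale, hg, hg]
    rw [hd, ← mul_sub, ← mul_add]
    exact ⟨by gcongr; exact (hφ a b).1, by gcongr; exact (hφ a b).2⟩
  have hbackward : 1 ≤ l := by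
    refine one_le_of_coarse_similarity _ hbd p h hh hgrowth l (3 * C) hl (by positivity) χ
      fun a b => ?_
    rw [← hescale]
    have h1 := hφ (χ a) (χ b)
    have h2 := abs_le.1 (dist_dist_dist_le (φ (χ a)) (φ (χ b)) (e a) (e b))
    have h3 := hχ a
    have h4 := hχ b
    constructor <;> linarith [h1.1, h1.2, h2.1, h2.2]
  exact hl1 (le_antisymm ((one_le_inv₀ hl).1 hforward) hbackward)
end

section
/- Let X be a metric space equipped with its Borel σ-algebra and a Borel measure μ. Assume that for every ρ > 0 there exist real constants 0 < v ≤ V < ∞ such that v ≤ μ(closedBall(x, ρ)) ≤ V for all x ∈ X. Fix p ∈ X and s > 0, and for r ≥ 0 let N(s, r) denote the least cardinality of a finite set T ⊆ X with closedBall(p, r) ⊆ ⋃_{t∈T} closedBall(t, s) (such finite covers exist under the hypotheses). Then limsup_{r→∞} log(N(s, r))/r = limsup_{r→∞} log(μ(closedBall(p, r)))/r, and liminf_{r→∞} log(N(s, r))/r = liminf_{r→∞} log(μ(closedBall(p, r)))/r (ball measures, which are finite and positive by hypothesis, interpreted as real numbers). -/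
open MeasureTheory

open Filter Metric

/-- If `f r ≤ g (r + c) + C` eventually, then asymptotic upper bounds on `g r / r` pass to `f r / r`
up to an arbitrarily small error. -/
lemma eventually_div_le_add_of_le_shift {f g : ℝ → ℝ} {c C : ℝ}
    (h : ∀ᶠ r in atTop, f r ≤ g (r + c) + C) {a ε : ℝ} (hε : 0 < ε)
    (ha : ∀ᶠ r in atTop, g r / r ≤ a) : ∀ᶠ r in atTop, f r / r ≤ a + ε := by
  filter_upwards [h, (tendsto_atTop_add_const_right atTop c tendsto_id).eventually ha,
    (tendsto_atTop_add_const_right atTop c tendsto_id).eventually (eventually_gt_atTop 0),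
    eventually_gt_atTop 0, eventually_ge_atTop ((a * c + C) / ε)] with r h1 h2 h3 h4 h5
  simp only [id] at h2 h3
  rw [div_le_iff₀ h3] at h2
  rw [div_le_iff₀ hε] at h5
  rw [div_le_iff₀ h4]
  linarith

/-- If `f r ≤ g (r + c) + C` eventually, then asymptotic lower bounds on `f r / r` pass to `g r / r`
up to an arbitrarily small error. -/
lemma eventually_sub_le_div_of_le_shift {f g : ℝ → ℝ} {c C : ℝ}
    (h : ∀ᶠ r in atTop, f r ≤ g (r + c) + C) {a ε : ℝ} (hε : 0 < ε)
    (ha : ∀ᶠ r in atTop, a ≤ f r / r) : ∀ᶠ r in atTop, a - ε ≤ g r / r := by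
  have ht := tendsto_atTop_add_const_right atTop (-c) (tendsto_id (α := ℝ))
  filter_upwards [ht.eventually h, ht.eventually ha, ht.eventually (eventually_gt_atTop 0),
    eventually_gt_atTop 0, eventually_ge_atTop ((a * c + C) / ε)] with r h1 h2 h3 h4 h5
  simp only [id, neg_add_cancel_right] at h1 h2 h3
  rw [le_div_iff₀ h3] at h2
  rw [div_le_iff₀ hε] at h5
  rw [le_div_iff₀ h4]
  linarith

lemma Real.sSup_eq_sSup_of_forall_sub_mem {A B : Set ℝ}
    (hAB : ∀ a ∈ A, ∀ ε > 0, a - ε ∈ B) (hBA : ∀ b ∈ B, ∀ ε > 0, b - ε ∈ A) :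
    sSup A = sSup B := by
  have bdd : ∀ {A B : Set ℝ}, (∀ a ∈ A, ∀ ε > 0, a - ε ∈ B) → BddAbove B → BddAbove A := by
    rintro A B h ⟨x, hx⟩
    exact ⟨x + 1, fun a ha => by linarith [hx (h a ha 1 one_pos)]⟩
  have le : ∀ {A B : Set ℝ}, (∀ a ∈ A, ∀ ε > 0, a - ε ∈ B) → A.Nonempty → BddAbove B →
      sSup A ≤ sSup B := by
    intro A B h hA hB
    refine csSup_le hA fun a ha => le_of_forall_pos_le_add fun ε hε => ?_
    linarith [le_csSup hB (h a ha ε hε)]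
  rcases A.eq_empty_or_nonempty with rfl | hA
  · rcases B.eq_empty_or_nonempty with rfl | ⟨b, hb⟩
    · rfl
    · exact (hBA b hb 1 one_pos).elim
  have hB : B.Nonempty := hA.elim fun a ha => ⟨_, hAB a ha 1 one_pos⟩
  by_cases hb : BddAbove B
  · exact (le hAB hA hb).antisymm (le hBA hB (bdd hAB hb))
  · rw [Real.sSup_of_not_bddAbove hb, Real.sSup_of_not_bddAbove fun h => hb (bdd hBA h)]

lemma Real.sInf_eq_sInf_of_forall_add_mem {A B : Set ℝ}
    (hAB : ∀ a ∈ A, ∀ ε > 0, a + ε ∈ B) (hBA : ∀ b ∈ B, ∀ ε > 0, b + ε ∈ A) :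
    sInf A = sInf B := by
  rw [Real.sInf_def, Real.sInf_def, Real.sSup_eq_sSup_of_forall_sub_mem]
  · intro a ha ε hε
    have := hAB _ ha ε hε
    rwa [Set.mem_neg, neg_sub, sub_eq_neg_add]
  · intro a ha ε hε
    have := hBA _ ha ε hε
    rwa [Set.mem_neg, neg_sub, sub_eq_neg_add]

/-- Finitely many `s`-separated points of a closed ball carry disjoint balls of radius `s / 2`. -/
lemma card_mul_le_measure_closedBall {X : Type*} [MetricSpace X] [MeasurableSpace X]
    [BorelSpace X] (μ : Measure X) {s r : ℝ} {p : X} {v : ENNReal}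
    (hv : ∀ x, v ≤ μ (closedBall x (s / 2))) {T : Finset X}
    (hT : (T : Set X) ⊆ closedBall p r) (hsep : (T : Set X).Pairwise fun x y => s < dist x y) :
    T.card * v ≤ μ (closedBall p (r + s / 2)) := by
  calc (T.card : ENNReal) * v = ∑ _x ∈ T, v := by simp
    _ ≤ ∑ x ∈ T, μ (closedBall x (s / 2)) := Finset.sum_le_sum fun x _ => hv x
    _ = μ (⋃ x ∈ T, closedBall x (s / 2)) := by
        refine (measure_biUnion_finset (fun x hx y hy hxy => ?_)
          fun x _ => isClosed_closedBall.measurableSet).symm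
        exact closedBall_disjoint_closedBall (by linarith [hsep hx hy hxy])
    _ ≤ μ (closedBall p (r + s / 2)) := by
        refine measure_mono (Set.iUnion₂_subset fun x hx => closedBall_subset_closedBall' ?_)
        linarith [mem_closedBall.1 (hT hx)]

/-- If the cardinality of `s`-separated finite subsets of `A` is bounded by `n`, then `A` is covered
by at most `n` closed balls of radius `s`. -/
lemma exists_card_le_subset_iUnion_closedBall {X : Type*} [MetricSpace X] {s : ℝ} (hs : 0 ≤ s)
    {A : Set X} {n : ℕ} (hn : ∀ T : Finset X, (T : Set X) ⊆ A →
      ((T : Set X).Pairwise fun x y => s < dist x y) → T.card ≤ n) :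
    ∃ T : Finset X, T.card ≤ n ∧ A ⊆ ⋃ t ∈ T, closedBall t s := by
  classical
  let S : Set ℕ := {k | ∃ T : Finset X, (T : Set X) ⊆ A ∧
    ((T : Set X).Pairwise fun x y => s < dist x y) ∧ T.card = k}
  have hS : BddAbove S := ⟨n, by rintro _ ⟨T, h1, h2, rfl⟩; exact hn T h1 h2⟩
  obtain ⟨T, hTA, hsep, hcard⟩ : sSup S ∈ S := Nat.sSup_mem ⟨0, ∅, by simp⟩ hS
  refine ⟨T, hn T hTA hsep, fun x hx => ?_⟩
  by_contra hcov
  simp only [Set.mem_iUnion, mem_closedBall, not_exists, not_le] at hcov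
  have hxT : x ∉ T := fun h => (hcov x h).not_ge (by simpa using hs)
  have hmem : (insert x T).card ∈ S := by
    refine ⟨insert x T, ?_, ?_, rfl⟩
    · rw [Finset.coe_insert]
      exact Set.insert_subset hx hTA
    · rw [Finset.coe_insert]
      exact hsep.insert fun y hy _ => ⟨hcov y hy, dist_comm x y ▸ hcov y hy⟩
  have := le_csSup hS hmem
  rw [Finset.card_insert_of_notMem hxT] at this
  omega

/-- The exponential growth rates of covering numbers N(s, r) coincide with those of ball
measures, under two-sided bounds on the measures of balls of any fixed radius. -/
theorem stmt_19 {X : Type*} [MetricSpace X] [MeasurableSpace X] [BorelSpace X]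
    (μ : Measure X)
    (hbd : ∀ ρ : ℝ, 0 < ρ → ∃ v V : ℝ, 0 < v ∧ v ≤ V ∧
      ∀ x : X, ENNReal.ofReal v ≤ μ (Metric.closedBall x ρ) ∧
        μ (Metric.closedBall x ρ) ≤ ENNReal.ofReal V)
    (p : X) (s : ℝ) (hs : 0 < s) (N : ℝ → ℕ)
    (hN : ∀ r : ℝ, N r = sInf {n : ℕ | ∃ T : Finset X, T.card = n ∧
      Metric.closedBall p r ⊆ ⋃ t ∈ T, Metric.closedBall t s})
    (hNex : ∀ r : ℝ, ∃ T : Finset X,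
      Metric.closedBall p r ⊆ ⋃ t ∈ T, Metric.closedBall t s) :
    (Filter.limsup (fun r : ℝ => Real.log (N r) / r) Filter.atTop =
      Filter.limsup (fun r : ℝ => Real.log ((μ (Metric.closedBall p r)).toReal) / r)
        Filter.atTop) ∧
    (Filter.liminf (fun r : ℝ => Real.log (N r) / r) Filter.atTop =
      Filter.liminf (fun r : ℝ => Real.log ((μ (Metric.closedBall p r)).toReal) / r)
        Filter.atTop) := by
  have hfin : ∀ r : ℝ, 0 < r → μ (closedBall p r) ≠ ⊤ := fun r hr => by
    obtain ⟨v, V, -, -, h⟩ := hbd r hr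
    exact ((h p).2.trans_lt ENNReal.ofReal_lt_top).ne
  have hpos : ∀ r : ℝ, 0 < r → 0 < (μ (closedBall p r)).toReal := fun r hr => by
    obtain ⟨v, V, hv, -, h⟩ := hbd r hr
    exact ENNReal.toReal_pos ((ENNReal.ofReal_pos.2 hv).trans_le (h p).1).ne' (hfin r hr)
  have hcover : ∀ r : ℝ, ∃ T : Finset X, T.card = N r ∧
      closedBall p r ⊆ ⋃ t ∈ T, closedBall t s := fun r => by
    obtain ⟨T, hT⟩ := hNex r
    have := Nat.sInf_mem (s := {n : ℕ | ∃ T : Finset X, T.card = n ∧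
      closedBall p r ⊆ ⋃ t ∈ T, closedBall t s}) ⟨_, T, rfl, hT⟩
    rwa [← hN] at this
  have hNpos : ∀ r : ℝ, 0 < r → (0 : ℝ) < N r := fun r hr => by
    obtain ⟨T, hT, hsub⟩ := hcover r
    obtain ⟨t, ht, -⟩ := Set.mem_iUnion₂.1 (hsub (mem_closedBall_self hr.le))
    exact_mod_cast hT ▸ Finset.card_pos.2 ⟨t, ht⟩
  obtain ⟨_, V, hv', hV', hV⟩ := hbd s hs
  have hVpos : 0 < V := hv'.trans_le hV'
  obtain ⟨v, _, hv, -, hvle⟩ := hbd (s / 2) (half_pos hs)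
  have hupper : ∀ᶠ r in atTop, Real.log ((μ (closedBall p r)).toReal) ≤
      Real.log (N (r + 0)) + Real.log V := by
    filter_upwards [eventually_gt_atTop 0] with r hr
    rw [add_zero, ← Real.log_mul (hNpos r hr).ne' hVpos.ne']
    refine Real.log_le_log (hpos r hr) ?_
    obtain ⟨T, hT, hsub⟩ := hcover r
    have hle : μ (closedBall p r) ≤ N r * ENNReal.ofReal V :=
      calc μ (closedBall p r) ≤ ∑ t ∈ T, μ (closedBall t s) :=
            (measure_mono hsub).trans (measure_biUnion_finset_le _ _)
        _ ≤ ∑ _t ∈ T, ENNReal.ofReal V := Finset.sum_le_sum fun t _ => (hV t).2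
        _ = N r * ENNReal.ofReal V := by simp [hT]
    have := ENNReal.toReal_mono (by finiteness) hle
    simpa [ENNReal.toReal_mul, ENNReal.toReal_ofReal hVpos.le] using this
  have hlower : ∀ᶠ r in atTop, Real.log (N r) ≤
      Real.log ((μ (closedBall p (r + s / 2))).toReal) + -Real.log v := by
    filter_upwards [eventually_gt_atTop 0] with r hr
    have hr' : 0 < r + s / 2 := by positivity
    rw [← sub_eq_add_neg, ← Real.log_div (hpos _ hr').ne' hv.ne']
    refine Real.log_le_log (hNpos r hr) ?_
    obtain ⟨T, hT, hsub⟩ := exists_card_le_subset_iUnion_closedBall hs.le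
      (A := closedBall p r) (n := ⌊(μ (closedBall p (r + s / 2))).toReal / v⌋₊) (by
        intro T hTA hsep
        have := ENNReal.toReal_mono (hfin _ hr')
          (card_mul_le_measure_closedBall μ (fun x => (hvle x).1) hTA hsep)
        rw [ENNReal.toReal_mul, ENNReal.toReal_natCast, ENNReal.toReal_ofReal hv.le] at this
        exact Nat.le_floor ((le_div_iff₀ hv).2 this))
    have hNT : N r ≤ T.card := hN r ▸ Nat.sInf_le ⟨T, rfl, hsub⟩
    exact (Nat.cast_le.2 (hNT.trans hT)).trans
      (Nat.floor_le (div_nonneg ENNReal.toReal_nonneg hv.le))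
  constructor
  · rw [limsup_eq, limsup_eq]
    exact Real.sInf_eq_sInf_of_forall_add_mem
      (fun a ha ε hε => eventually_div_le_add_of_le_shift
        (g := fun r => Real.log (N r)) hupper hε ha)
      (fun a ha ε hε => eventually_div_le_add_of_le_shift
        (g := fun r => Real.log ((μ (closedBall p r)).toReal)) hlower hε ha)
  · rw [liminf_eq, liminf_eq]
    exact Real.sSup_eq_sSup_of_forall_sub_mem
      (fun a ha ε hε => eventually_sub_le_div_of_le_shift
        (g := fun r => Real.log ((μ (closedBall p r)).toReal)) hlower hε ha)
      (fun a ha ε hε => eventually_sub_le_div_of_le_shift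
        (g := fun r => Real.log (N r)) hupper hε ha)
end
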